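/- (Oracle bound on the generalisation gap) Let $d\ge 0$ and $m,n\ge 1$ be integers. Let $\phi:\mathbb{R}\to\mathbb{R}$ be twice differentiable with $|\phi|\le B_\phi$, $|\phi'|\le B_{\phi'}$, $|\phi''|\le B_{\phi''}$, let $u\in\{\pm 1/\sqrt m\}^m$ be fixed, and for $W=(W_1,\dots,W_m)\in\mathbb{R}^{d\times m}$ put $f_W(x)=\sum_{k=1}^m u_k\,\phi(\langle W_k,x\rangle)$ and $\ell(W,(x,y))=\tfrac12(f_W(x)-y)^2$. Let $C_x,C_y,C_0>0$, let $P$ be a probability distribution on $\mathbb{R}^d\times\mathbb{R}$ with $\|x\|_2\le C_x$ and $|y|\le C_y$ for $P$-almost every $(x,y)$, and let $S=(z_1,\dots,z_n)$ be i.i.d. from $P$. Write $L_S(W)=\frac1n\sum_{i=1}^n\ell(W,z_i)$ and $L(W)=\mathbf{E}_{z\sim P}\,\ell(W,z)$. Fix $W_0\in\mathbb{R}^{d\times m}$ with $\ell(W_0,z)\le C_0$ for $P$-almost every $z$, a step size $\eta>0$, and let $W_{s+1}=W_s-\eta\nabla L_S(W_s)$ for $s\ge 0$. Set $\rho=C_x^2\big(B_{\phi'}^2+B_{\phi''}B_\phi+B_{\phi''}C_y/\sqrt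 m\big)$. Fix an integer $T\ge 1$ and suppose that $\eta\le 1/(2\rho)$ (no restriction if $\rho=0$) and $$m\ \ge\ 144\,(\eta T)^2\,C_x^4\,C_0\,B_{\phi''}^2\,\big(4B_{\phi'}C_x\sqrt{\eta T}+\sqrt2\big)^2 .$$ Then $$\mathbf{E}\big[L(W_T)-L_S(W_T)\big]\ \le\ b\,\frac{\eta T}{n}\Big(1+\frac{\eta T}{n}\Big)\,\mathbf{E}\bigg[\min_{W\in\mathbb{R}^{d\times m}}\Big\{L_S(W)+\frac{\|W-W_0\|_F^2}{\eta T}+\frac{\tilde b\,\|W-W_0\|_F^3}{\sqrt m}\Big\}+\tilde b\,C_0\,\frac{(\eta T)^{3/2}}{\sqrt m}\bigg],$$ where $b=16e^3\,C_x^{2}B_{\phi'}^2\,(1+C_x^{2}B_{\phi'}^2)$, $\tilde b=C_x^2B_{\phi''}(B_{\phi'}C_x+C_0)$, and the expectations are over the i.i.d. sample $S$. -/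

import Mathlib

open MeasureTheory

noncomputable section

/-- The parameter space `ℝ^{d×m}` of a width-`m` shallow network on `ℝ^d`: the entry `(k, j)` is
the `j`-th coordinate of the `k`-th hidden weight vector `W_k`. Its Euclidean norm is the Frobenius
norm of the matrix. -/
abbrev Param (d m : ℕ) : Type := EuclideanSpace ℝ (Fin m × Fin d)

/-- Inputs live in `ℝ^d` with the Euclidean norm. -/
abbrev Input (d : ℕ) : Type := EuclideanSpace ℝ (Fin d)

/-- Shallow network `f_W(x) = ∑ₖ uₖ φ(⟨Wₖ, x⟩)`. -/
def nnet {d m : ℕ} (φ : ℝ → ℝ) (u : Fin m → ℝ) (W : Param d m) (x : Input d) : ℝ :=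
  ∑ k : Fin m, u k * φ (∑ j : Fin d, W (k, j) * x j)

/-- Squared loss `ℓ(W, (x, y)) = (f_W(x) − y)² / 2`. -/
def sqLoss {d m : ℕ} (φ : ℝ → ℝ) (u : Fin m → ℝ) (W : Param d m) (z : Input d × ℝ) : ℝ :=
  (nnet φ u W z.1 - z.2) ^ 2 / 2

/-- Empirical risk `L_S(W) = (1/n) ∑ᵢ ℓ(W, zᵢ)`. -/
def empRisk {d m n : ℕ} (φ : ℝ → ℝ) (u : Fin m → ℝ) (S : Fin n → Input d × ℝ)
    (W : Param d m) : ℝ :=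
  (∑ i : Fin n, sqLoss φ u W (S i)) / n

/-- Statistical risk `L(W) = E_{z ∼ P} ℓ(W, z)`. -/
def popRisk {d m : ℕ} (φ : ℝ → ℝ) (u : Fin m → ℝ) (P : Measure (Input d × ℝ))
    (W : Param d m) : ℝ :=
  ∫ z, sqLoss φ u W z ∂P

/-- Gradient-descent iterates `W_{t+1} = W_t − η ∇L(W_t)` started at `W0`. -/
def gdIter {d m : ℕ} (η : ℝ) (L : Param d m → ℝ) (W0 : Param d m) : ℕ → Param d m
  | 0 => W0
  | t + 1 => gdIter η L W0 t - η • gradient L (gdIter η L W0 t)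

end

/-- A scalar function `g` with gradient field `a` that is bounded by `M` and `κ`-Lipschitz, together
with the matching second-order Taylor bound. -/
structure IsSmoothFeature {E : Type*} [NormedAddCommGroup E] [InnerProductSpace ℝ E]
    (g : E → ℝ) (a : E → E) (M κ : ℝ) : Prop where
  bound_nonneg : 0 ≤ M
  lip_nonneg : 0 ≤ κ
  norm_le : ∀ W, ‖a W‖ ≤ M
  norm_sub_le : ∀ W W', ‖a W - a W'‖ ≤ κ * ‖W - W'‖
  taylor : ∀ W W', |g W' - g W - inner ℝ (a W) (W' - W)| ≤ κ / 2 * ‖W' - W‖ ^ 2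

/-- Mean of half squared residuals. -/
noncomputable def meanSq {E : Type*} {n : ℕ} (g : Fin n → E → ℝ) (W : E) : ℝ :=
  (∑ i, g i W ^ 2 / 2) / n

/-- Gradient of `meanSq` for residuals `g` with gradients `a`. -/
noncomputable def meanSqGrad {E : Type*} [NormedAddCommGroup E] [InnerProductSpace ℝ E] {n : ℕ}
    (g : Fin n → E → ℝ) (a : Fin n → E → E) (W : E) : E :=
  (n : ℝ)⁻¹ • ∑ i, g i W • a i W

section Feature

variable {E : Type*} [NormedAddCommGroup E] [InnerProductSpace ℝ E]
  {g : E → ℝ} {a : E → E} {M κ : ℝ}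

theorem IsSmoothFeature.hasGradientAt [CompleteSpace E] (h : IsSmoothFeature g a M κ) (W : E) :
    HasGradientAt g (a W) W := by
  rw [hasGradientAt_iff_isLittleO]
  have h1 : (fun x' => g x' - g W - inner ℝ (a W) (x' - W)) =O[nhds W]
      fun x' => ‖x' - W‖ ^ 2 := by
    refine Asymptotics.IsBigO.of_bound (κ / 2) (Filter.Eventually.of_forall fun x => ?_)
    rw [Real.norm_eq_abs, Real.norm_of_nonneg (by positivity)]
    exact h.taylor W x
  refine h1.trans_isLittleO ?_
  have h2 : (fun x' : E => ‖x' - W‖ ^ 2) =o[nhds W] fun x' => ‖x' - W‖ ^ 1 := by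
    refine (Asymptotics.isLittleO_pow_pow one_lt_two).comp_tendsto ?_
    have : Filter.Tendsto (fun x' : E => ‖x' - W‖) (nhds W) (nhds ‖W - W‖) :=
      (continuous_id.sub continuous_const).norm.continuousAt
    simpa using this
  simpa using h2

theorem IsSmoothFeature.abs_sub_le [CompleteSpace E] (h : IsSmoothFeature g a M κ) (W W' : E) :
    |g W' - g W| ≤ M * ‖W' - W‖ := by
  refine Convex.norm_image_sub_le_of_norm_hasFDerivWithin_le (𝕜 := ℝ) (s := Set.univ)
    (f' := fun x => (InnerProductSpace.toDual ℝ E) (a x))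
    (fun x _ => (h.hasGradientAt x).hasFDerivAt.hasFDerivWithinAt) (fun x _ => ?_) convex_univ
    (Set.mem_univ _) (Set.mem_univ _)
  simpa using h.norm_le x

theorem IsSmoothFeature.half_sq_ge (h : IsSmoothFeature g a M κ) (W W' : E) :
    g W ^ 2 / 2 + g W * inner ℝ (a W) (W' - W) - |g W| * κ / 2 * ‖W' - W‖ ^ 2
      ≤ g W' ^ 2 / 2 := by
  have h1 : |g W * (g W' - g W - inner ℝ (a W) (W' - W))| ≤ |g W| * (κ / 2 * ‖W' - W‖ ^ 2) := by
    rw [abs_mul]; exact mul_le_mul_of_nonneg_left (h.taylor W W') (abs_nonneg _)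
  have h2 := (abs_le.1 h1).1
  nlinarith [sq_nonneg (g W' - g W)]

theorem IsSmoothFeature.half_sq_le [CompleteSpace E] (h : IsSmoothFeature g a M κ) (W W' : E) :
    g W' ^ 2 / 2 ≤
      g W ^ 2 / 2 + g W * inner ℝ (a W) (W' - W) + (|g W| * κ + M ^ 2) / 2 * ‖W' - W‖ ^ 2 := by
  have h1 : |g W * (g W' - g W - inner ℝ (a W) (W' - W))| ≤ |g W| * (κ / 2 * ‖W' - W‖ ^ 2) := by
    rw [abs_mul]; exact mul_le_mul_of_nonneg_left (h.taylor W W') (abs_nonneg _)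
  have h2 := (abs_le.1 h1).2
  have h3 : (g W' - g W) ^ 2 ≤ (M * ‖W' - W‖) ^ 2 := by
    rw [← sq_abs (g W' - g W)]
    exact pow_le_pow_left₀ (abs_nonneg _) (h.abs_sub_le W W') 2
  nlinarith

/-- The increment of `g • a` is a rank-one positive term plus a small remainder. -/
theorem IsSmoothFeature.norm_smul_sub_le (h : IsSmoothFeature g a M κ) (W W' : E) {R : ℝ}
    (hW : |g W| ≤ R) (hW' : |g W'| ≤ R) :
    ‖g W • a W - g W' • a W' -
      inner ℝ ((1 / 2 : ℝ) • (a W + a W')) (W - W') • ((1 / 2 : ℝ) • (a W + a W'))‖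
      ≤ κ * (R + M * ‖W - W'‖ / 2) * ‖W - W'‖ := by
  set v := (1 / 2 : ℝ) • (a W + a W') with hv
  set r := g W - g W' - inner ℝ v (W - W') with hr
  have hvM : ‖v‖ ≤ M := by
    rw [hv, norm_smul]
    have := norm_add_le (a W) (a W')
    have h1 := h.norm_le W
    have h2 := h.norm_le W'
    norm_num
    linarith
  have hrb : |r| ≤ κ / 2 * ‖W - W'‖ ^ 2 := by
    have t1 := abs_le.1 (h.taylor W W')
    have t2 := abs_le.1 (h.taylor W' W)
    have e1 : inner ℝ (a W) (W' - W) = - inner ℝ (a W) (W - W') := by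
      rw [← inner_neg_right, neg_sub]
    rw [e1, norm_sub_rev W' W] at t1
    have e2 : inner ℝ v (W - W') = (inner ℝ (a W) (W - W') + inner ℝ (a W') (W - W')) / 2 := by
      rw [hv, real_inner_smul_left, inner_add_left]; ring
    rw [hr, e2, abs_le]
    constructor <;> linarith [t1.1, t1.2, t2.1, t2.2]
  have key : g W • a W - g W' • a W' - inner ℝ v (W - W') • v
      = r • v + ((g W + g W') / 2) • (a W - a W') := by
    have : inner ℝ v (W - W') = g W - g W' - r := by rw [hr]; ring
    rw [this, sub_smul _ r]
    nth_rewrite 1 [hv]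
    module
  rw [key]
  have hg : |(g W + g W') / 2| ≤ R := by
    rw [abs_le] at *
    constructor <;> linarith [hW.1, hW.2, hW'.1, hW'.2]
  clear_value r v
  calc _ ≤ |r| * ‖v‖ + |(g W + g W') / 2| * ‖a W - a W'‖ := by
        refine (norm_add_le _ _).trans ?_
        rw [norm_smul r v, norm_smul, Real.norm_eq_abs, Real.norm_eq_abs]
    _ ≤ (κ / 2 * ‖W - W'‖ ^ 2) * M + R * (κ * ‖W - W'‖) := by
        gcongr
        · exact mul_nonneg (by linarith [h.lip_nonneg]) (sq_nonneg _)
        · exact (abs_nonneg _).trans hW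
        · exact h.norm_sub_le W W'
    _ = _ := by ring

end Feature

theorem meanSq_nonneg {E : Type*} {n : ℕ} (g : Fin n → E → ℝ) (W : E) : 0 ≤ meanSq g W := by
  unfold meanSq; positivity

section Empirical

variable {E : Type*} [NormedAddCommGroup E] [InnerProductSpace ℝ E] {n : ℕ}
  {g : Fin n → E → ℝ} {a : Fin n → E → E} {M κ : ℝ}

theorem inner_meanSqGrad (W v : E) :
    inner ℝ (meanSqGrad g a W) v = (∑ i, g i W * inner ℝ (a i W) v) / n := by
  rw [meanSqGrad, real_inner_smul_left, sum_inner, div_eq_inv_mul]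
  simp_rw [real_inner_smul_left]

theorem hasGradientAt_meanSq [CompleteSpace E] (h : ∀ i, IsSmoothFeature (g i) (a i) M κ) (W : E) :
    HasGradientAt (meanSq g) (meanSqGrad g a W) W := by
  rw [hasGradientAt_iff_hasFDerivAt]
  have h1 := (HasFDerivAt.fun_sum (u := Finset.univ) fun i _ =>
    (((h i).hasGradientAt W).hasFDerivAt.pow 2).mul_const (2⁻¹ : ℝ)).mul_const ((n : ℝ)⁻¹)
  have h2 : meanSq g = fun W => (∑ i, g i W ^ 2 * (2⁻¹ : ℝ)) * (n : ℝ)⁻¹ := by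
    funext W
    simp only [meanSq, div_eq_mul_inv]
  rw [h2]
  refine h1.congr_fderiv ?_
  ext v
  simp only [InnerProductSpace.toDual_apply_apply, inner_meanSqGrad]
  simp only [smul_apply, sum_apply, smul_eq_mul,
    InnerProductSpace.toDual_apply_apply, div_eq_inv_mul]
  congr 1
  refine Finset.sum_congr rfl fun i _ => ?_
  simp only [nsmul_eq_mul, Nat.cast_ofNat, Nat.add_one_sub_one, pow_one]
  ring

theorem norm_meanSqGrad_sq_le (h : ∀ i, IsSmoothFeature (g i) (a i) M κ) (W : E) :
    ‖meanSqGrad g a W‖ ^ 2 ≤ 2 * M ^ 2 * meanSq g W := by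
  rcases Nat.eq_zero_or_pos n with rfl | hn
  · simp [meanSqGrad, meanSq]
  have hn' : (0 : ℝ) < n := by exact_mod_cast hn
  have h1 : ‖∑ i, g i W • a i W‖ ≤ ∑ i, |g i W| * M := by
    refine (norm_sum_le _ _).trans (Finset.sum_le_sum fun i _ => ?_)
    rw [norm_smul, Real.norm_eq_abs]
    exact mul_le_mul_of_nonneg_left ((h i).norm_le W) (abs_nonneg _)
  have h2 : (∑ i, |g i W| * M) ^ 2 ≤ n * ∑ i, (|g i W| * M) ^ 2 := by
    simpa using sq_sum_le_card_mul_sum_sq (s := Finset.univ) (f := fun i => |g i W| * M)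
  have h3 : ∑ i, (|g i W| * M) ^ 2 = 2 * M ^ 2 * ∑ i, g i W ^ 2 / 2 := by
    rw [Finset.mul_sum]
    refine Finset.sum_congr rfl fun i _ => ?_
    rw [mul_pow, sq_abs]; ring
  rw [meanSqGrad, norm_smul, mul_pow, norm_inv, Real.norm_natCast, meanSq]
  calc _ ≤ ((n : ℝ)⁻¹) ^ 2 * (n * (2 * M ^ 2 * ∑ i, g i W ^ 2 / 2)) := by
        rw [← h3]
        gcongr
        exact (pow_le_pow_left₀ (norm_nonneg _) h1 2).trans h2
    _ = _ := by field_simp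

theorem meanSq_ge (hn : 1 ≤ n) (h : ∀ i, IsSmoothFeature (g i) (a i) M κ) {W : E} {R : ℝ}
    (hR : ∀ i, |g i W| ≤ R) (W' : E) :
    meanSq g W + inner ℝ (meanSqGrad g a W) (W' - W) - R * κ / 2 * ‖W' - W‖ ^ 2
      ≤ meanSq g W' := by
  have hn' : (0 : ℝ) < n := by exact_mod_cast hn
  rw [inner_meanSqGrad, meanSq, meanSq, le_div_iff₀ hn', sub_mul, add_mul,
    div_mul_cancel₀ _ hn'.ne', div_mul_cancel₀ _ hn'.ne', ← Finset.sum_add_distrib]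
  have : R * κ / 2 * ‖W' - W‖ ^ 2 * n = ∑ _i : Fin n, R * κ / 2 * ‖W' - W‖ ^ 2 := by
    simp; ring
  rw [this, ← Finset.sum_sub_distrib]
  refine Finset.sum_le_sum fun i _ => le_trans ?_ ((h i).half_sq_ge W W')
  have := (h i).lip_nonneg
  gcongr
  exact hR i

theorem meanSq_le [CompleteSpace E] (hn : 1 ≤ n) (h : ∀ i, IsSmoothFeature (g i) (a i) M κ) {W : E}
    {R : ℝ} (hR : ∀ i, |g i W| ≤ R) (W' : E) :
    meanSq g W' ≤ meanSq g W + inner ℝ (meanSqGrad g a W) (W' - W)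
      + (R * κ + M ^ 2) / 2 * ‖W' - W‖ ^ 2 := by
  have hn' : (0 : ℝ) < n := by exact_mod_cast hn
  rw [inner_meanSqGrad, meanSq, meanSq, div_le_iff₀ hn', add_mul, add_mul,
    div_mul_cancel₀ _ hn'.ne', div_mul_cancel₀ _ hn'.ne', ← Finset.sum_add_distrib]
  have : (R * κ + M ^ 2) / 2 * ‖W' - W‖ ^ 2 * n
      = ∑ _i : Fin n, (R * κ + M ^ 2) / 2 * ‖W' - W‖ ^ 2 := by
    simp; ring
  rw [this, ← Finset.sum_add_distrib]
  refine Finset.sum_le_sum fun i _ => ((h i).half_sq_le W W').trans ?_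
  have := (h i).lip_nonneg
  gcongr
  exact hR i

end Empirical

section ContractiveStep

variable {E : Type*} [NormedAddCommGroup E] [InnerProductSpace ℝ E]

/-- A gradient step along an average of rank-one positive operators is nonexpansive. -/
theorem norm_sub_smul_sum_rankOne_le {ι : Type*} (s : Finset ι) (v : ι → E) {M c : ℝ}
    (hv : ∀ i ∈ s, ‖v i‖ ≤ M) (hc : 0 ≤ c) (hcM : c * s.card * M ^ 2 ≤ 2) (w : E) :
    ‖w - c • ∑ i ∈ s, inner ℝ (v i) w • v i‖ ≤ ‖w‖ := by
  set q := ∑ i ∈ s, inner ℝ (v i) w ^ 2 with hq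
  have hq0 : 0 ≤ q := Finset.sum_nonneg fun _ _ => sq_nonneg _
  have h1 : inner ℝ w (∑ i ∈ s, inner ℝ (v i) w • v i) = q := by
    rw [inner_sum, hq]
    refine Finset.sum_congr rfl fun i _ => ?_
    rw [real_inner_smul_right, real_inner_comm]; ring
  have h2 : ‖∑ i ∈ s, inner ℝ (v i) w • v i‖ ^ 2 ≤ s.card * M ^ 2 * q := by
    have a1 : ‖∑ i ∈ s, inner ℝ (v i) w • v i‖ ≤ ∑ i ∈ s, |inner ℝ (v i) w| * M := by
      refine (norm_sum_le _ _).trans (Finset.sum_le_sum fun i hi => ?_)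
      rw [norm_smul, Real.norm_eq_abs]
      exact mul_le_mul_of_nonneg_left (hv i hi) (abs_nonneg _)
    refine (pow_le_pow_left₀ (norm_nonneg _) a1 2).trans ?_
    refine (sq_sum_le_card_mul_sum_sq).trans (le_of_eq ?_)
    rw [hq, mul_assoc, Finset.mul_sum _ _ (M ^ 2)]
    congr 1
    refine Finset.sum_congr rfl fun i _ => ?_
    rw [mul_pow, sq_abs]; ring
  refine le_of_sq_le_sq ?_ (norm_nonneg w)
  rw [norm_sub_sq_real, real_inner_smul_right, h1, norm_smul, mul_pow, Real.norm_eq_abs, sq_abs]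
  have h3 : c ^ 2 * ‖∑ i ∈ s, inner ℝ (v i) w • v i‖ ^ 2 ≤ c ^ 2 * (s.card * M ^ 2 * q) := by
    gcongr
  have h4 : c * q * (c * s.card * M ^ 2) ≤ c * q * 2 := by gcongr
  nlinarith

theorem norm_sub_smul_sum_feature_le {ι : Type*} (s : Finset ι) {g : ι → E → ℝ} {a : ι → E → E}
    {M κ : ℝ} (h : ∀ i ∈ s, IsSmoothFeature (g i) (a i) M κ) {W W' : E} {R c : ℝ}
    (hW : ∀ i ∈ s, |g i W| ≤ R) (hW' : ∀ i ∈ s, |g i W'| ≤ R) (hc : 0 ≤ c)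
    (hcM : c * s.card * M ^ 2 ≤ 2) :
    ‖(W - W') - c • ∑ i ∈ s, (g i W • a i W - g i W' • a i W')‖
      ≤ (1 + c * s.card * (κ * (R + M * ‖W - W'‖ / 2))) * ‖W - W'‖ := by
  set v : ι → E := fun i => (1 / 2 : ℝ) • (a i W + a i W') with hv
  have hvM : ∀ i ∈ s, ‖v i‖ ≤ M := by
    intro i hi
    rw [hv, norm_smul]
    have := norm_add_le (a i W) (a i W')
    have h1 := (h i hi).norm_le W
    have h2 := (h i hi).norm_le W'
    norm_num
    linarith
  have e : (W - W') - c • ∑ i ∈ s, (g i W • a i W - g i W' • a i W')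
      = ((W - W') - c • ∑ i ∈ s, inner ℝ (v i) (W - W') • v i)
        - c • ∑ i ∈ s, (g i W • a i W - g i W' • a i W' - inner ℝ (v i) (W - W') • v i) := by
    rw [Finset.sum_sub_distrib (g := fun i => inner ℝ (v i) (W - W') • v i), smul_sub]
    abel
  rw [e]
  have h2 : ‖∑ i ∈ s, (g i W • a i W - g i W' • a i W' - inner ℝ (v i) (W - W') • v i)‖
      ≤ s.card * (κ * (R + M * ‖W - W'‖ / 2) * ‖W - W'‖) := by
    rw [← nsmul_eq_mul]
    refine (norm_sum_le _ _).trans (Finset.sum_le_card_nsmul s _ _ fun i hi => ?_)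
    exact (h i hi).norm_smul_sub_le W W' (hW i hi) (hW' i hi)
  calc _ ≤ ‖W - W'‖ + c * (s.card * (κ * (R + M * ‖W - W'‖ / 2) * ‖W - W'‖)) := by
        refine (norm_sub_le _ _).trans ?_
        rw [norm_smul, Real.norm_of_nonneg hc]
        gcongr
        exact norm_sub_smul_sum_rankOne_le s v hvM hc hcM _
    _ = _ := by ring

end ContractiveStep

theorem one_add_pow_le_of_mul_le {x : ℝ} {T : ℕ} (hx : 0 ≤ x) (h : T * x ≤ 1 / 12) :
    (1 + x) ^ T ≤ 12 / 11 := by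
  have h1 : (1 + x) ^ T ≤ Real.exp (1 / 12) := by
    calc (1 + x) ^ T ≤ Real.exp x ^ T := by
          gcongr
          linarith [Real.add_one_le_exp x]
      _ = Real.exp (T * x) := by rw [← Real.exp_nat_mul]
      _ ≤ _ := Real.exp_le_exp.2 h
  have h2 : 1 - 1 / 12 ≤ Real.exp (-(1 / 12)) := Real.one_sub_le_exp_neg _
  have h3 : Real.exp (-(1 / 12)) * Real.exp (1 / 12) = 1 := by
    rw [← Real.exp_add]; simp
  have h4 := Real.exp_pos (1 / 12)
  nlinarith

section GradientDescent

variable {E : Type*} [NormedAddCommGroup E] [InnerProductSpace ℝ E] {n : ℕ}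

/-- `w` is the gradient-descent trajectory with step size `η` of the mean squared residual of
smooth features `g`, where all residuals are bounded by `B`, the step size is below the inverse
smoothness, and all losses at initialisation are at most `C`. -/
structure IsGDTrajectory (g : Fin n → E → ℝ) (a : Fin n → E → E) (M κ B C η : ℝ)
    (w : ℕ → E) : Prop where
  card_pos : 1 ≤ n
  feature : ∀ i, IsSmoothFeature (g i) (a i) M κ
  residual_le : ∀ i W, |g i W| ≤ B
  step_nonneg : 0 ≤ η
  step_le : η * (B * κ + M ^ 2) ≤ 1
  init_nonneg : 0 ≤ C
  init_le : ∀ i, g i (w 0) ^ 2 / 2 ≤ C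
  succ : ∀ s, w (s + 1) = w s - η • meanSqGrad g a (w s)

/-- Uniform bound on the residuals along a trajectory of total length `τ`. -/
noncomputable def residualBound (M C τ : ℝ) : ℝ :=
  √2 * √C + M * (√2 * √τ * √C)

namespace IsGDTrajectory

variable {g : Fin n → E → ℝ} {a : Fin n → E → E} {M κ B C η : ℝ} {w : ℕ → E}

theorem feature_nonneg (h : IsGDTrajectory g a M κ B C η w) : 0 ≤ M ∧ 0 ≤ κ ∧ 0 ≤ B :=
  have i : Fin n := ⟨0, h.card_pos⟩
  ⟨(h.feature i).bound_nonneg, (h.feature i).lip_nonneg,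
    (abs_nonneg _).trans (h.residual_le i (w 0))⟩

theorem meanSq_init_le (h : IsGDTrajectory g a M κ B C η w) : meanSq g (w 0) ≤ C := by
  have hn : (0 : ℝ) < n := by exact_mod_cast h.card_pos
  rw [meanSq, div_le_iff₀ hn]
  calc _ ≤ ∑ _i : Fin n, C := Finset.sum_le_sum fun i _ => h.init_le i
    _ = _ := by simp [mul_comm]

theorem step_mul_sq_le (h : IsGDTrajectory g a M κ B C η w) : η * M ^ 2 ≤ 1 := by
  obtain ⟨-, h1, h2⟩ := h.feature_nonneg
  have := mul_nonneg h.step_nonneg (mul_nonneg h2 h1)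
  linarith [h.step_le]

variable [CompleteSpace E]

theorem descent (h : IsGDTrajectory g a M κ B C η w) (s : ℕ) :
    meanSq g (w (s + 1)) + η / 2 * ‖meanSqGrad g a (w s)‖ ^ 2 ≤ meanSq g (w s) := by
  have h1 := meanSq_le h.card_pos h.feature (W := w s) (fun i => h.residual_le i (w s)) (w (s + 1))
  have h2 : w (s + 1) - w s = -(η • meanSqGrad g a (w s)) := by rw [h.succ]; abel
  rw [h2, inner_neg_right, real_inner_smul_right, real_inner_self_eq_norm_sq, norm_neg, norm_smul,
    mul_pow, Real.norm_eq_abs, sq_abs] at h1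
  have h3 := mul_le_mul_of_nonneg_right h.step_le
    (mul_nonneg h.step_nonneg (sq_nonneg ‖meanSqGrad g a (w s)‖))
  nlinarith

theorem antitone (h : IsGDTrajectory g a M κ B C η w) : Antitone fun s => meanSq g (w s) := by
  refine antitone_nat_of_succ_le fun s => ?_
  have := mul_nonneg (div_nonneg h.step_nonneg zero_le_two) (sq_nonneg ‖meanSqGrad g a (w s)‖)
  linarith [h.descent s]

theorem norm_sub_init_sq_le (h : IsGDTrajectory g a M κ B C η w) (s : ℕ) :
    ‖w s - w 0‖ ^ 2 ≤ 2 * (η * s) * C := by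
  have e : w s - w 0 = ∑ r ∈ Finset.range s, (w (r + 1) - w r) := (Finset.sum_range_sub w s).symm
  have h1 : ∀ r, ‖w (r + 1) - w r‖ ^ 2 ≤ 2 * η * (meanSq g (w r) - meanSq g (w (r + 1))) := by
    intro r
    have h2 : w (r + 1) - w r = -(η • meanSqGrad g a (w r)) := by rw [h.succ]; abel
    rw [h2, norm_neg, norm_smul, mul_pow, Real.norm_eq_abs, sq_abs]
    have := mul_le_mul_of_nonneg_left (h.descent r) h.step_nonneg
    nlinarith
  calc ‖w s - w 0‖ ^ 2 ≤ (∑ r ∈ Finset.range s, ‖w (r + 1) - w r‖) ^ 2 := by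
        rw [e]; gcongr; exact norm_sum_le _ _
    _ ≤ s * ∑ r ∈ Finset.range s, ‖w (r + 1) - w r‖ ^ 2 := by
        simpa using sq_sum_le_card_mul_sum_sq (s := Finset.range s)
          (f := fun r => ‖w (r + 1) - w r‖)
    _ ≤ s * ∑ r ∈ Finset.range s, 2 * η * (meanSq g (w r) - meanSq g (w (r + 1))) := by
        gcongr with r _; exact h1 r
    _ = 2 * (η * s) * (meanSq g (w 0) - meanSq g (w s)) := by
        rw [← Finset.mul_sum, Finset.sum_range_sub' (fun r => meanSq g (w r))]; ring
    _ ≤ _ := by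
        have := h.step_nonneg
        gcongr
        linarith [h.meanSq_init_le, meanSq_nonneg g (w s)]

theorem norm_sub_init_le (h : IsGDTrajectory g a M κ B C η w) {s T : ℕ} (hs : s ≤ T) :
    ‖w s - w 0‖ ≤ √2 * √(η * T) * √C := by
  have h0 := h.step_nonneg
  rw [← Real.sqrt_mul (by positivity), ← Real.sqrt_mul (by positivity)]
  refine Real.le_sqrt_of_sq_le ((h.norm_sub_init_sq_le s).trans ?_)
  have := h.init_nonneg
  gcongr

theorem abs_residual_le (h : IsGDTrajectory g a M κ B C η w) {s T : ℕ} (hs : s ≤ T) (i : Fin n) :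
    |g i (w s)| ≤ residualBound M C (η * T) := by
  have h1 := (h.feature i).abs_sub_le (w 0) (w s)
  have h2 : |g i (w 0)| ≤ √2 * √C := by
    rw [← Real.sqrt_mul (by positivity)]
    refine Real.abs_le_sqrt ?_
    linarith [h.init_le i]
  have h3 := mul_le_mul_of_nonneg_left (h.norm_sub_init_le hs) h.feature_nonneg.1
  have h4 : |g i (w s)| ≤ |g i (w 0)| + |g i (w s) - g i (w 0)| := by
    have := abs_add_le (g i (w 0)) (g i (w s) - g i (w 0))
    simpa using this
  unfold residualBound
  linarith

theorem distance_step (h : IsGDTrajectory g a M κ B C η w) {s T : ℕ} (hs : s ≤ T) (W : E)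
    (hη : η * (2 * M ^ 2) ≤ 1) :
    ‖w (s + 1) - W‖ ^ 2 + η * meanSq g (w s)
      ≤ (1 + η * (residualBound M C (η * T) * κ)) * ‖w s - W‖ ^ 2 + 2 * η * meanSq g W := by
  have h0 := h.step_nonneg
  have h1 := meanSq_ge h.card_pos h.feature (W := w s) (fun i => h.abs_residual_le hs i) W
  have h2 : w (s + 1) - W = (w s - W) - η • meanSqGrad g a (w s) := by rw [h.succ]; abel
  have h3 : inner ℝ (meanSqGrad g a (w s)) (W - w s)
      = - inner ℝ (w s - W) (meanSqGrad g a (w s)) := by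
    rw [real_inner_comm, ← inner_neg_left, neg_sub]
  rw [h2, norm_sub_sq_real, real_inner_smul_right, norm_smul, mul_pow, Real.norm_eq_abs, sq_abs]
  rw [h3, norm_sub_rev W] at h1
  have h4 := mul_le_mul_of_nonneg_left h1 h0
  have h5 := mul_le_mul_of_nonneg_left (norm_meanSqGrad_sq_le h.feature (w s)) (sq_nonneg η)
  have h6 := mul_le_mul_of_nonneg_right hη (mul_nonneg h0 (meanSq_nonneg g (w s)))
  nlinarith

theorem residualBound_nonneg (h : IsGDTrajectory g a M κ B C η w) (T : ℕ) :
    0 ≤ residualBound M C (η * T) :=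
  (abs_nonneg _).trans (h.abs_residual_le T.zero_le ⟨0, h.card_pos⟩)

/-- Along the trajectory the mean training loss is within a constant factor of the regularised
oracle loss. -/
theorem average_le (h : IsGDTrajectory g a M κ B C η w) {T : ℕ} (hT : 1 ≤ T) (hpos : 0 < η)
    (hη : η * (2 * M ^ 2) ≤ 1) (hκ : η * T * (residualBound M C (η * T) * κ) ≤ 1 / 12) (W : E) :
    (∑ s ∈ Finset.range T, meanSq g (w s)) / T
      ≤ 3 * (meanSq g W + ‖W - w 0‖ ^ 2 / (η * T)) := by
  set ε := η * (residualBound M C (η * T) * κ) with hε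
  have hε0 : 0 ≤ ε :=
    mul_nonneg hpos.le (mul_nonneg (h.residualBound_nonneg T) h.feature_nonneg.2.1)
  have hL := meanSq_nonneg g W
  have key : ∀ s ≤ T, ‖w s - W‖ ^ 2 + η * ∑ r ∈ Finset.range s, meanSq g (w r)
      ≤ (1 + ε) ^ s * (‖w 0 - W‖ ^ 2 + 2 * η * s * meanSq g W) := by
    intro s
    induction s with
    | zero => intro _; simp
    | succ s ih =>
      intro hs
      have i1 := ih (by omega)
      have i2 := h.distance_step (T := T) (by omega : s ≤ T) W hη
      rw [← hε] at i2
      have i3 : 0 ≤ ε * (η * ∑ r ∈ Finset.range s, meanSq g (w r)) :=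
        mul_nonneg hε0 (mul_nonneg hpos.le (Finset.sum_nonneg fun r _ => meanSq_nonneg g _))
      have i4 : 1 ≤ (1 + ε) ^ (s + 1) := one_le_pow₀ (by linarith)
      have i5 := mul_le_mul_of_nonneg_left i1 (by linarith : 0 ≤ 1 + ε)
      have i6 := mul_le_mul_of_nonneg_right i4 (by positivity : 0 ≤ 2 * η * meanSq g W)
      rw [Finset.sum_range_succ]
      have e : (1 + ε) ^ (s + 1) * (‖w 0 - W‖ ^ 2 + 2 * η * ((s + 1 : ℕ) : ℝ) * meanSq g W)
          = (1 + ε) * ((1 + ε) ^ s * (‖w 0 - W‖ ^ 2 + 2 * η * s * meanSq g W))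
            + (1 + ε) ^ (s + 1) * (2 * η * meanSq g W) := by
        push_cast; ring
      rw [e]
      linarith
  have k := key T le_rfl
  have hq : (1 + ε) ^ T ≤ 12 / 11 :=
    one_add_pow_le_of_mul_le hε0 (by rw [hε]; linarith)
  have hT' : (0 : ℝ) < T := by exact_mod_cast hT
  have k2 : η * ∑ r ∈ Finset.range T, meanSq g (w r)
      ≤ 12 / 11 * (‖w 0 - W‖ ^ 2 + 2 * η * T * meanSq g W) := by
    have := mul_le_mul_of_nonneg_right hq
      (by positivity : 0 ≤ ‖w 0 - W‖ ^ 2 + 2 * η * T * meanSq g W)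
    linarith [sq_nonneg ‖w T - W‖]
  rw [norm_sub_rev W, div_le_iff₀ hT']
  have e : 3 * (meanSq g W + ‖w 0 - W‖ ^ 2 / (η * T)) * T
      = (3 * (η * T * meanSq g W) + 3 * ‖w 0 - W‖ ^ 2) / η := by field_simp
  rw [e, le_div_iff₀ hpos]
  have : 0 ≤ η * T * meanSq g W := by positivity
  nlinarith [sq_nonneg ‖w 0 - W‖]

theorem le_average (h : IsGDTrajectory g a M κ B C η w) {T : ℕ} (hT : 1 ≤ T) :
    meanSq g (w T) ≤ (∑ s ∈ Finset.range T, meanSq g (w s)) / T := by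
  have hT' : (0 : ℝ) < T := by exact_mod_cast hT
  rw [le_div_iff₀ hT']
  calc _ = ∑ _s ∈ Finset.range T, meanSq g (w T) := by simp [mul_comm]
    _ ≤ _ := Finset.sum_le_sum fun s hs => h.antitone (Finset.mem_range.1 hs).le

variable {g' : Fin n → E → ℝ} {a' : Fin n → E → E} {w' : ℕ → E}

/-- One step of two trajectories whose training sets differ only in the `i`-th example. -/
theorem norm_sub_succ_le (h : IsGDTrajectory g a M κ B C η w)
    (h' : IsGDTrajectory g' a' M κ B C η w') (h0 : w 0 = w' 0) {i : Fin n}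
    (hg : ∀ j, j ≠ i → g j = g' j) (ha : ∀ j, j ≠ i → a j = a' j) {s T : ℕ} (hs : s ≤ T) :
    ‖w (s + 1) - w' (s + 1)‖
      ≤ (1 + η * (κ * (residualBound M C (η * T) + M * (√2 * √(η * T) * √C)))) * ‖w s - w' s‖
        + η / n * M * (|g i (w s)| + |g' i (w' s)|) := by
  obtain ⟨hM, hκ, -⟩ := h.feature_nonneg
  have hη := h.step_nonneg
  have hn : (0 : ℝ) < n := by exact_mod_cast h.card_pos
  have hc : 0 ≤ η / n := div_nonneg hη hn.le
  set J := Finset.univ.erase i with hJ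
  have hcard : η / n * (J.card : ℝ) ≤ η := by
    have : (J.card : ℝ) ≤ n := by
      have := Finset.card_le_univ J
      rw [Fintype.card_fin] at this
      exact_mod_cast this
    calc _ ≤ η / n * n := by gcongr
      _ = η := by field_simp
  have hne : ∀ j ∈ J, j ≠ i := fun j hj => Finset.ne_of_mem_erase hj
  have e : w (s + 1) - w' (s + 1)
      = ((w s - w' s) - (η / n) • ∑ j ∈ J, (g j (w s) • a j (w s) - g j (w' s) • a j (w' s)))
        - (η / n) • (g i (w s) • a i (w s) - g' i (w' s) • a' i (w' s)) := by
    have e1 : ∑ j, g j (w s) • a j (w s)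
        = g i (w s) • a i (w s) + ∑ j ∈ J, g j (w s) • a j (w s) :=
      (Finset.add_sum_erase _ _ (Finset.mem_univ i)).symm
    have e2 : ∑ j, g' j (w' s) • a' j (w' s)
        = g' i (w' s) • a' i (w' s) + ∑ j ∈ J, g j (w' s) • a j (w' s) := by
      rw [← Finset.add_sum_erase _ _ (Finset.mem_univ i)]
      congr 1
      exact Finset.sum_congr rfl fun j hj => by rw [hg j (hne j hj), ha j (hne j hj)]
    rw [h.succ, h'.succ, meanSqGrad, meanSqGrad, e1, e2, Finset.sum_sub_distrib,
      smul_smul, smul_smul, ← div_eq_mul_inv]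
    module
  have hD : ‖w s - w' s‖ ≤ 2 * (√2 * √(η * T) * √C) := by
    have t : w s - w' s = (w s - w 0) - (w' s - w' 0) := by rw [h0]; abel
    rw [t]
    linarith [norm_sub_le (w s - w 0) (w' s - w' 0), h.norm_sub_init_le hs,
      h'.norm_sub_init_le hs]
  have b1 := norm_sub_smul_sum_feature_le J (fun j _ => h.feature j)
    (W := w s) (W' := w' s) (fun j _ => h.abs_residual_le hs j)
    (fun j hj => by rw [hg j (hne j hj)]; exact h'.abs_residual_le hs j) hc
    (by
      have := mul_le_mul_of_nonneg_right hcard (sq_nonneg M)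
      linarith [h.step_mul_sq_le])
  have hR := h.residualBound_nonneg T
  have b2 : η / n * (J.card : ℝ)
        * (κ * (residualBound M C (η * T) + M * ‖w s - w' s‖ / 2))
      ≤ η * (κ * (residualBound M C (η * T) + M * (√2 * √(η * T) * √C))) := by
    gcongr ?_ * (κ * (_ + ?_))
    · have := mul_le_mul_of_nonneg_left hD hM
      linarith
  have b3 : ‖g i (w s) • a i (w s) - g' i (w' s) • a' i (w' s)‖
      ≤ M * (|g i (w s)| + |g' i (w' s)|) := by
    refine (norm_sub_le _ _).trans ?_
    rw [norm_smul, norm_smul, Real.norm_eq_abs, Real.norm_eq_abs]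
    have c1 := mul_le_mul_of_nonneg_left ((h.feature i).norm_le (w s)) (abs_nonneg (g i (w s)))
    have c2 := mul_le_mul_of_nonneg_left ((h'.feature i).norm_le (w' s))
      (abs_nonneg (g' i (w' s)))
    linarith
  rw [e]
  refine (norm_sub_le _ _).trans (add_le_add (b1.trans ?_) ?_)
  · gcongr
  · rw [norm_smul, Real.norm_of_nonneg hc, mul_assoc]
    gcongr

theorem norm_sub_sq_le (h : IsGDTrajectory g a M κ B C η w)
    (h' : IsGDTrajectory g' a' M κ B C η w') (h0 : w 0 = w' 0) {i : Fin n}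
    (hg : ∀ j, j ≠ i → g j = g' j) (ha : ∀ j, j ≠ i → a j = a' j) {T : ℕ}
    (hκ : η * T * (κ * (residualBound M C (η * T) + M * (√2 * √(η * T) * √C))) ≤ 1 / 12) :
    ‖w T - w' T‖ ^ 2 ≤ (η / n * M) ^ 2 *
      (5 * (T * ∑ s ∈ Finset.range T, (g i (w s) ^ 2 / 2 + g' i (w' s) ^ 2 / 2))) := by
  obtain ⟨hM, hκ0, -⟩ := h.feature_nonneg
  have hη := h.step_nonneg
  have hR := h.residualBound_nonneg T
  set ε := η * (κ * (residualBound M C (η * T) + M * (√2 * √(η * T) * √C))) with hε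
  have hε0 : 0 ≤ ε := by positivity
  set x : ℕ → ℝ := fun s => |g i (w s)| + |g' i (w' s)| with hx
  have hx0 : ∀ s, 0 ≤ x s := fun s => by positivity
  have key : ∀ s ≤ T, ‖w s - w' s‖ ≤ (1 + ε) ^ s * (η / n * M * ∑ r ∈ Finset.range s, x r) := by
    intro s
    induction s with
    | zero => intro _; simp [h0]
    | succ s ih =>
      intro hs
      have i1 := ih (by omega)
      have i2 := h.norm_sub_succ_le h' h0 hg ha (by omega : s ≤ T)
      rw [← hε] at i2
      have i4 : 1 ≤ (1 + ε) ^ (s + 1) := one_le_pow₀ (by linarith)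
      have i5 := mul_le_mul_of_nonneg_left i1 (by linarith : 0 ≤ 1 + ε)
      have i6 := mul_le_mul_of_nonneg_right i4
        (mul_nonneg (by positivity) (hx0 s) : 0 ≤ η / n * M * x s)
      rw [Finset.sum_range_succ]
      have e : (1 + ε) ^ (s + 1) * (η / n * M * (∑ r ∈ Finset.range s, x r + x s))
          = (1 + ε) * ((1 + ε) ^ s * (η / n * M * ∑ r ∈ Finset.range s, x r))
            + (1 + ε) ^ (s + 1) * (η / n * M * x s) := by ring
      rw [e]
      linarith
  have hq : (1 + ε) ^ T ≤ 12 / 11 :=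
    one_add_pow_le_of_mul_le hε0 (by rw [hε]; linarith)
  have hX : 0 ≤ ∑ r ∈ Finset.range T, x r := Finset.sum_nonneg fun r _ => hx0 r
  have hS : (∑ r ∈ Finset.range T, x r) ^ 2
      ≤ T * (4 * ∑ s ∈ Finset.range T, (g i (w s) ^ 2 / 2 + g' i (w' s) ^ 2 / 2)) := by
    have s1 : (∑ r ∈ Finset.range T, x r) ^ 2 ≤ T * ∑ r ∈ Finset.range T, x r ^ 2 := by
      simpa using sq_sum_le_card_mul_sum_sq (s := Finset.range T) (f := x)
    refine s1.trans ?_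
    rw [Finset.mul_sum _ _ 4]
    gcongr with r _
    simp only [hx]
    nlinarith [sq_nonneg (|g i (w r)| - |g' i (w' r)|), sq_abs (g i (w r)), sq_abs (g' i (w' r))]
  have k1 : ‖w T - w' T‖ ≤ 12 / 11 * (η / n * M * ∑ r ∈ Finset.range T, x r) :=
    (key T le_rfl).trans (by gcongr)
  have hS0 : 0 ≤ (T : ℝ) * ∑ s ∈ Finset.range T, (g i (w s) ^ 2 / 2 + g' i (w' s) ^ 2 / 2) := by
    positivity
  calc _ ≤ (12 / 11 * (η / n * M * ∑ r ∈ Finset.range T, x r)) ^ 2 := by gcongr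
    _ = (η / n * M) ^ 2 * (144 / 121 * (∑ r ∈ Finset.range T, x r) ^ 2) := by ring
    _ ≤ _ := mul_le_mul_of_nonneg_left (by linarith) (sq_nonneg _)

/-- Replace-one stability of gradient descent, measured by the loss of the replaced example. -/
theorem loss_sub_le (h : IsGDTrajectory g a M κ B C η w)
    (h' : IsGDTrajectory g' a' M κ B C η w') (h0 : w 0 = w' 0) {i : Fin n}
    (hg : ∀ j, j ≠ i → g j = g' j) (ha : ∀ j, j ≠ i → a j = a' j) {T : ℕ} (hT : 1 ≤ T)
    (hκ : η * T * (κ * (residualBound M C (η * T) + M * (√2 * √(η * T) * √C))) ≤ 1 / 12)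
    {lam : ℝ} (hlam : lam = M ^ 2 * (η * T / n)) :
    g i (w' T) ^ 2 / 2 - g i (w T) ^ 2 / 2 ≤ lam * (g i (w T) ^ 2 / 2)
      + (lam + lam ^ 2) * (5 / 2) *
        ((∑ s ∈ Finset.range T, (g i (w s) ^ 2 / 2 + g' i (w' s) ^ 2 / 2)) / T) := by
  have hη := h.step_nonneg
  have hT' : (0 : ℝ) < T := by exact_mod_cast hT
  set Q : ℝ := (∑ s ∈ Finset.range T, (g i (w s) ^ 2 / 2 + g' i (w' s) ^ 2 / 2)) / T with hQ
  have hQ0 : 0 ≤ Q := by positivity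
  have hl0 : 0 ≤ lam := by rw [hlam]; positivity
  have h1 := h.norm_sub_sq_le h' h0 hg ha hκ
  have h2 := (h.feature i).abs_sub_le (w T) (w' T)
  rw [norm_sub_rev] at h2
  have h3 : (g i (w' T) - g i (w T)) ^ 2 ≤ lam ^ 2 * (5 * Q) := by
    calc _ = |g i (w' T) - g i (w T)| ^ 2 := (sq_abs _).symm
      _ ≤ (M * ‖w T - w' T‖) ^ 2 := by gcongr
      _ = M ^ 2 * ‖w T - w' T‖ ^ 2 := by ring
      _ ≤ M ^ 2 * ((η / n * M) ^ 2 *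
          (5 * (T * ∑ s ∈ Finset.range T, (g i (w s) ^ 2 / 2 + g' i (w' s) ^ 2 / 2)))) := by
        gcongr
      _ = _ := by
        have hQT : ∑ s ∈ Finset.range T, (g i (w s) ^ 2 / 2 + g' i (w' s) ^ 2 / 2) = Q * T := by
          rw [hQ, div_mul_cancel₀ _ hT'.ne']
        rw [hQT, hlam]
        ring
  have h4 : |g i (w' T) - g i (w T)| ≤ lam * √(5 * Q) := by
    rw [← Real.sqrt_sq hl0, ← Real.sqrt_mul (sq_nonneg _)]
    exact Real.abs_le_sqrt h3
  have h5 : √(5 * Q) ^ 2 = 5 * Q := Real.sq_sqrt (by positivity)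
  have h6 : g i (w T) * (g i (w' T) - g i (w T)) ≤ lam * ((g i (w T) ^ 2 + 5 * Q) / 2) := by
    calc _ ≤ |g i (w T)| * |g i (w' T) - g i (w T)| := by rw [← abs_mul]; exact le_abs_self _
      _ ≤ |g i (w T)| * (lam * √(5 * Q)) := by gcongr
      _ = lam * (|g i (w T)| * √(5 * Q)) := by ring
      _ ≤ _ := by
        gcongr
        nlinarith [sq_nonneg (|g i (w T)| - √(5 * Q)), sq_abs (g i (w T))]
  nlinarith

end IsGDTrajectory

end GradientDescent

theorem abs_deriv_sub_deriv_le {φ : ℝ → ℝ} {B : ℝ} (hφ' : Differentiable ℝ (deriv φ))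
    (hB : ∀ s, |deriv (deriv φ) s| ≤ B) (s t : ℝ) : |deriv φ t - deriv φ s| ≤ B * |t - s| :=
  Convex.norm_image_sub_le_of_norm_deriv_le (𝕜 := ℝ) (s := Set.univ) (fun x _ => hφ' x)
    (fun x _ => hB x) convex_univ (Set.mem_univ _) (Set.mem_univ _)

theorem abs_taylor_one_le {φ : ℝ → ℝ} {B : ℝ} (hφ : Differentiable ℝ φ)
    (hφ' : Differentiable ℝ (deriv φ)) (hB : ∀ s, |deriv (deriv φ) s| ≤ B) (s t : ℝ) :
    |φ t - φ s - deriv φ s * (t - s)| ≤ B / 2 * (t - s) ^ 2 := by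
  have hf : ∀ r : ℝ, HasDerivAt (fun r => φ (s + r * (t - s)) - φ s - deriv φ s * (r * (t - s)))
      ((deriv φ (s + r * (t - s)) - deriv φ s) * (t - s)) r := by
    intro r
    have h1 : HasDerivAt (fun r : ℝ => r * (t - s)) (t - s) r := by
      simpa using (hasDerivAt_id r).mul_const (t - s)
    have h2 := ((hφ (s + r * (t - s))).hasDerivAt.comp r (h1.const_add s)).sub_const (φ s)
    exact (h2.sub (h1.const_mul (deriv φ s))).congr_deriv (by ring)
  have hb : ∀ r : ℝ, HasDerivAt (fun r : ℝ => B / 2 * (t - s) ^ 2 * r ^ 2)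
      (B * (t - s) ^ 2 * r) r := by
    intro r
    exact ((hasDerivAt_pow 2 r).const_mul (B / 2 * (t - s) ^ 2)).congr_deriv (by simp; ring)
  have := image_norm_le_of_norm_deriv_right_le_deriv_boundary (a := (0 : ℝ)) (b := 1)
    (fun r _ => (hf r).continuousAt.continuousWithinAt) (fun r _ => (hf r).hasDerivWithinAt)
    (by simp) hb (fun r hr => ?_) (Set.right_mem_Icc.2 zero_le_one)
  · simpa using this
  · rw [norm_mul, Real.norm_eq_abs, Real.norm_eq_abs]
    have h1 := abs_deriv_sub_deriv_le hφ' hB s (s + r * (t - s))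
    rw [add_sub_cancel_left, abs_mul, abs_of_nonneg hr.1] at h1
    calc _ ≤ B * (r * |t - s|) * |t - s| := by gcongr
      _ = B * |t - s| ^ 2 * r := by ring
      _ = _ := by rw [sq_abs]

section Network

variable {d m : ℕ}

/-- Pre-activation `⟨W_k, x⟩` of the `k`-th hidden unit. -/
noncomputable def preact (W : Param d m) (x : Input d) (k : Fin m) : ℝ :=
  ∑ j : Fin d, W (k, j) * x j

/-- The rank-one parameter matrix with entries `b k * x j`. -/
noncomputable def rankOneParam (b : Fin m → ℝ) (x : Input d) : Param d m :=
  WithLp.toLp 2 fun p => b p.1 * x p.2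

/-- Gradient of the network output in the parameters. -/
noncomputable def nnetGrad (φ : ℝ → ℝ) (u : Fin m → ℝ) (W : Param d m) (x : Input d) : Param d m :=
  rankOneParam (fun k => u k * deriv φ (preact W x k)) x

theorem preact_sub (W W' : Param d m) (x : Input d) (k : Fin m) :
    preact (W - W') x k = preact W x k - preact W' x k := by
  simp [preact, sub_mul, Finset.sum_sub_distrib]

theorem norm_rankOneParam_sq (b : Fin m → ℝ) (x : Input d) :
    ‖rankOneParam b x‖ ^ 2 = (∑ k, b k ^ 2) * ‖x‖ ^ 2 := by
  rw [EuclideanSpace.real_norm_sq_eq, EuclideanSpace.real_norm_sq_eq, Fintype.sum_prod_type,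
    Finset.sum_mul_sum]
  simp [rankOneParam, mul_pow]

theorem rankOneParam_sub (b b' : Fin m → ℝ) (x : Input d) :
    rankOneParam b x - rankOneParam b' x = rankOneParam (fun k => b k - b' k) x := by
  ext p
  simp [rankOneParam, sub_mul]

theorem inner_rankOneParam (b : Fin m → ℝ) (x : Input d) (V : Param d m) :
    inner ℝ (rankOneParam b x) V = ∑ k, b k * preact V x k := by
  rw [PiLp.inner_apply, Fintype.sum_prod_type]
  refine Finset.sum_congr rfl fun k _ => ?_
  rw [preact, Finset.mul_sum]
  refine Finset.sum_congr rfl fun j _ => ?_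
  simp [rankOneParam]
  ring

theorem sum_preact_sq_le (W : Param d m) (x : Input d) :
    ∑ k, preact W x k ^ 2 ≤ ‖W‖ ^ 2 * ‖x‖ ^ 2 := by
  rw [EuclideanSpace.real_norm_sq_eq W, Fintype.sum_prod_type, Finset.sum_mul]
  refine Finset.sum_le_sum fun k _ => ?_
  rw [EuclideanSpace.real_norm_sq_eq x]
  exact Finset.sum_mul_sq_le_sq_mul_sq _ _ _

theorem isSmoothFeature_nnet (hm : 1 ≤ m) {φ : ℝ → ℝ} {B' B'' : ℝ} (hφ : Differentiable ℝ φ)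
    (hφ' : Differentiable ℝ (deriv φ)) (hB' : ∀ s, |deriv φ s| ≤ B')
    (hB'' : ∀ s, |deriv (deriv φ) s| ≤ B'') {u : Fin m → ℝ} (hu : ∀ k, |u k| = 1 / √m)
    {C : ℝ} {x : Input d} (hx : ‖x‖ ≤ C) (y : ℝ) :
    IsSmoothFeature (fun W : Param d m => nnet φ u W x - y) (fun W => nnetGrad φ u W x)
      (B' * C) (C ^ 2 * B'' / √m) := by
  have hm0 : (0 : ℝ) < m := by exact_mod_cast hm
  have hC : 0 ≤ C := (norm_nonneg x).trans hx
  have hB'0 : 0 ≤ B' := (abs_nonneg _).trans (hB' 0)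
  have hB''0 : 0 ≤ B'' := (abs_nonneg _).trans (hB'' 0)
  have hu2 : ∀ k, u k ^ 2 = 1 / m := fun k => by
    rw [← sq_abs, hu, div_pow, Real.sq_sqrt hm0.le, one_pow]
  refine ⟨by positivity, by positivity, fun W => ?_, fun W W' => ?_, fun W W' => ?_⟩
  · refine le_of_sq_le_sq ?_ (by positivity)
    rw [nnetGrad, norm_rankOneParam_sq, mul_pow]
    have h1 : ∑ k, (u k * deriv φ (preact W x k)) ^ 2 ≤ B' ^ 2 := by
      calc _ ≤ ∑ _k : Fin m, 1 / (m : ℝ) * B' ^ 2 := by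
            refine Finset.sum_le_sum fun k _ => ?_
            rw [mul_pow, hu2, ← sq_abs (deriv φ _)]
            gcongr
            exact hB' _
        _ = _ := by simp; field_simp
    gcongr
  · refine le_of_sq_le_sq ?_ (by positivity)
    rw [nnetGrad, nnetGrad, rankOneParam_sub, norm_rankOneParam_sq]
    have h1 : ∑ k, (u k * deriv φ (preact W x k) - u k * deriv φ (preact W' x k)) ^ 2
        ≤ 1 / m * B'' ^ 2 * (‖W - W'‖ ^ 2 * ‖x‖ ^ 2) := by
      calc _ ≤ ∑ k, 1 / m * B'' ^ 2 * preact (W - W') x k ^ 2 := by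
            refine Finset.sum_le_sum fun k _ => ?_
            rw [← mul_sub, mul_pow, hu2, mul_assoc, ← mul_pow, preact_sub]
            refine mul_le_mul_of_nonneg_left ?_ (by positivity)
            rw [← sq_abs, ← sq_abs (B'' * _), abs_mul, abs_of_nonneg hB''0]
            gcongr
            exact abs_deriv_sub_deriv_le hφ' hB'' _ _
        _ ≤ _ := by
            rw [← Finset.mul_sum]
            gcongr
            exact sum_preact_sq_le _ _
    calc _ ≤ 1 / m * B'' ^ 2 * (‖W - W'‖ ^ 2 * ‖x‖ ^ 2) * ‖x‖ ^ 2 := by gcongr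
      _ ≤ 1 / m * B'' ^ 2 * (‖W - W'‖ ^ 2 * C ^ 2) * C ^ 2 := by gcongr
      _ = _ := by
        rw [mul_pow, div_pow, Real.sq_sqrt hm0.le]; ring
  · have e : (nnet φ u W' x - y) - (nnet φ u W x - y) - inner ℝ (nnetGrad φ u W x) (W' - W)
        = ∑ k, u k * (φ (preact W' x k) - φ (preact W x k)
            - deriv φ (preact W x k) * (preact W' x k - preact W x k)) := by
      rw [nnetGrad, inner_rankOneParam, sub_sub_sub_cancel_right, nnet, nnet,
        ← Finset.sum_sub_distrib, ← Finset.sum_sub_distrib]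
      refine Finset.sum_congr rfl fun k _ => ?_
      rw [preact_sub, preact, preact]
      ring
    rw [e]
    refine (Finset.abs_sum_le_sum_abs _ _).trans ?_
    calc _ ≤ ∑ k, 1 / √m * (B'' / 2) * preact (W' - W) x k ^ 2 := by
          refine Finset.sum_le_sum fun k _ => ?_
          rw [abs_mul, hu, mul_assoc, preact_sub]
          gcongr
          exact abs_taylor_one_le hφ hφ' hB'' _ _
      _ ≤ 1 / √m * (B'' / 2) * (‖W' - W‖ ^ 2 * C ^ 2) := by
          rw [← Finset.mul_sum]
          gcongr
          refine (sum_preact_sq_le _ _).trans ?_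
          gcongr
      _ = _ := by ring

theorem abs_nnet_le (hm : 1 ≤ m) {φ : ℝ → ℝ} {B : ℝ} (hB : ∀ s, |φ s| ≤ B) {u : Fin m → ℝ}
    (hu : ∀ k, |u k| = 1 / √m) (W : Param d m) (x : Input d) : |nnet φ u W x| ≤ √m * B := by
  have hm0 : (0 : ℝ) < m := by exact_mod_cast hm
  refine (Finset.abs_sum_le_sum_abs _ _).trans ?_
  calc _ ≤ ∑ _k : Fin m, 1 / √m * B := by
        refine Finset.sum_le_sum fun k _ => ?_
        rw [abs_mul, hu]
        gcongr
        exact hB _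
    _ = √m * B := by
        have : (m : ℝ) = √m * √m := (Real.mul_self_sqrt hm0.le).symm
        have h2 : √m ≠ 0 := (Real.sqrt_pos.2 hm0).ne'
        simp only [Finset.sum_const, Finset.card_univ, Fintype.card_fin, nsmul_eq_mul]
        nth_rewrite 1 [this]
        field_simp

/-- Residuals of the network on a sample. -/
noncomputable def resid {n : ℕ} (φ : ℝ → ℝ) (u : Fin m → ℝ) (S : Fin n → Input d × ℝ) (i : Fin n)
    (W : Param d m) : ℝ := nnet φ u W (S i).1 - (S i).2

/-- Gradients of the residuals on a sample. -/
noncomputable def residGrad {n : ℕ} (φ : ℝ → ℝ) (u : Fin m → ℝ) (S : Fin n → Input d × ℝ)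
    (i : Fin n) (W : Param d m) : Param d m := nnetGrad φ u W (S i).1

theorem empRisk_eq_meanSq {n : ℕ} (φ : ℝ → ℝ) (u : Fin m → ℝ) (S : Fin n → Input d × ℝ) :
    empRisk φ u S = meanSq (resid φ u S) := rfl

theorem gradient_empRisk {n : ℕ} (hm : 1 ≤ m) {φ : ℝ → ℝ} {B' B'' : ℝ} (hφ : Differentiable ℝ φ)
    (hφ' : Differentiable ℝ (deriv φ)) (hB' : ∀ s, |deriv φ s| ≤ B')
    (hB'' : ∀ s, |deriv (deriv φ) s| ≤ B'') {u : Fin m → ℝ} (hu : ∀ k, |u k| = 1 / √m)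
    (S : Fin n → Input d × ℝ) (W : Param d m) :
    gradient (empRisk φ u S) W = meanSqGrad (resid φ u S) (residGrad φ u S) W := by
  rw [empRisk_eq_meanSq]
  refine (hasGradientAt_meanSq (fun i => isSmoothFeature_nnet hm hφ hφ' hB' hB'' hu
    (C := ∑ j, ‖(S j).1‖) ?_ (S i).2) W).gradient
  exact Finset.single_le_sum (f := fun j => ‖(S j).1‖) (fun j _ => norm_nonneg _)
    (Finset.mem_univ i)

theorem continuous_preact (k : Fin m) :
    Continuous fun p : Param d m × Input d => preact p.1 p.2 k := by
  unfold preact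
  fun_prop

theorem continuous_nnet {φ : ℝ → ℝ} (hφ : Continuous φ) (u : Fin m → ℝ) :
    Continuous fun p : Param d m × Input d => nnet φ u p.1 p.2 := by
  have : ∀ k, Continuous fun p : Param d m × Input d => φ (preact p.1 p.2 k) :=
    fun k => hφ.comp (continuous_preact k)
  exact continuous_finsetSum _ fun k _ => continuous_const.mul (this k)

theorem continuous_nnetGrad {φ : ℝ → ℝ} (hφ' : Continuous (deriv φ)) (u : Fin m → ℝ) :
    Continuous fun p : Param d m × Input d => nnetGrad φ u p.1 p.2 := by
  have : ∀ k, Continuous fun p : Param d m × Input d => deriv φ (preact p.1 p.2 k) :=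
    fun k => hφ'.comp (continuous_preact k)
  unfold nnetGrad rankOneParam
  fun_prop

theorem continuous_sqLoss {X : Type*} [TopologicalSpace X] {φ : ℝ → ℝ} (hφ : Continuous φ)
    (u : Fin m → ℝ) {W : X → Param d m} {z : X → Input d × ℝ} (hW : Continuous W)
    (hz : Continuous z) : Continuous fun p => sqLoss φ u (W p) (z p) := by
  have : Continuous fun p => nnet φ u (W p) (z p).1 :=
    (continuous_nnet hφ u).comp (hW.prodMk hz.fst)
  unfold sqLoss
  fun_prop

theorem continuous_empRisk {n : ℕ} {φ : ℝ → ℝ} (hφ : Continuous φ) (u : Fin m → ℝ)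
    (W : Param d m) : Continuous fun S : Fin n → Input d × ℝ => empRisk φ u S W :=
  (continuous_finsetSum _ fun i _ =>
    continuous_sqLoss hφ u continuous_const (continuous_apply i)).div_const _

theorem continuous_gdIter {n : ℕ} (hm : 1 ≤ m) {φ : ℝ → ℝ} {B' B'' : ℝ} (hφ : Differentiable ℝ φ)
    (hφ' : Differentiable ℝ (deriv φ)) (hB' : ∀ s, |deriv φ s| ≤ B')
    (hB'' : ∀ s, |deriv (deriv φ) s| ≤ B'') {u : Fin m → ℝ} (hu : ∀ k, |u k| = 1 / √m)
    (η : ℝ) (W0 : Param d m) (t : ℕ) :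
    Continuous fun S : Fin n → Input d × ℝ => gdIter η (empRisk φ u S) W0 t := by
  induction t with
  | zero => exact continuous_const
  | succ t ih =>
    simp only [gdIter, gradient_empRisk hm hφ hφ' hB' hB'' hu, meanSqGrad, resid, residGrad]
    have h1 : ∀ i, Continuous fun S : Fin n → Input d × ℝ =>
        nnet φ u (gdIter η (empRisk φ u S) W0 t) (S i).1 := fun i =>
      (continuous_nnet hφ.continuous u).comp (ih.prodMk (by fun_prop))
    have h2 : ∀ i, Continuous fun S : Fin n → Input d × ℝ =>
        nnetGrad φ u (gdIter η (empRisk φ u S) W0 t) (S i).1 := fun i =>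
      (continuous_nnetGrad hφ'.continuous u).comp (ih.prodMk (by fun_prop))
    fun_prop

end Network

section Resampling

variable {Z : Type*} [MeasurableSpace Z] {n : ℕ}

/-- Exchanging the `i`-th sample point with an independent copy preserves the joint law. -/
theorem measurePreserving_update_swap (P : Measure Z) [IsProbabilityMeasure P] (i : Fin n) :
    MeasurePreserving (fun p : (Fin n → Z) × Z => (Function.update p.1 i p.2, p.1 i))
      ((Measure.pi fun _ => P).prod P) ((Measure.pi fun _ => P).prod P) := by
  obtain ⟨k, rfl⟩ : ∃ k, n = k + 1 := ⟨n - 1, by have := i.pos; omega⟩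
  have e := measurePreserving_piFinSuccAbove (fun _ : Fin (k + 1) => P) i
  have h1 := e.prod (MeasurePreserving.id P)
  have h2 := measurePreserving_prodAssoc P (Measure.pi fun _ : Fin k => P) P
  have h3 := Measure.measurePreserving_swap (μ := P) (ν := (Measure.pi fun _ : Fin k => P).prod P)
  have h4 := (Measure.measurePreserving_swap (μ := Measure.pi fun _ : Fin k => P) (ν := P)).prod
    (MeasurePreserving.id P)
  have h5 := e.symm.prod (MeasurePreserving.id P)
  have h := h5.comp (h4.comp (h3.comp (h2.comp h1)))
  convert h using 1
  funext p
  refine Prod.ext ?_ ?_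
  · simp only [Function.comp, Prod.map, MeasurableEquiv.piFinSuccAbove, MeasurableEquiv.prodAssoc]
    simp [Fin.insertNthEquiv]
  · simp [MeasurableEquiv.piFinSuccAbove, MeasurableEquiv.prodAssoc, Fin.insertNthEquiv]

theorem ae_pi_mem (P : Measure Z) [IsProbabilityMeasure P] {G : Set Z} (hG : ∀ᵐ z ∂P, z ∈ G) :
    ∀ᵐ S ∂(Measure.pi fun _ : Fin n => P), ∀ i, S i ∈ G :=
  ae_all_iff.2 fun i =>
    (Measure.quasiMeasurePreserving_eval (fun _ : Fin n => P) i).ae hG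

/-- Expected generalisation gap of a learning process from a replace-one stability bound. -/
theorem expected_gap_le_of_replace_one (P : Measure Z) [IsProbabilityMeasure P] (hn : 1 ≤ n)
    (T : ℕ) (F : ℕ → (Fin n → Z) → Z → ℝ)
    (hF : ∀ s, Measurable fun p : (Fin n → Z) × Z => F s p.1 p.2)
    {G : Set Z} (hG : ∀ᵐ z ∂P, z ∈ G) {K : ℝ} (hK : ∀ s S, ∀ z ∈ G, |F s S z| ≤ K) {c₁ c₂ : ℝ}
    (hstab : ∀ (S : Fin n → Z) (z : Z) (i : Fin n), (∀ j, S j ∈ G) → z ∈ G →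
      F T (Function.update S i z) (S i) - F T S (S i) ≤ c₁ * F T S (S i)
        + c₂ * ((∑ s ∈ Finset.range T, (F s S (S i) + F s (Function.update S i z) z)) / T)) :
    ∫ S, ((∫ z, F T S z ∂P) - (∑ i, F T S (S i)) / n) ∂(Measure.pi fun _ : Fin n => P)
      ≤ c₁ * ∫ S, (∑ i, F T S (S i)) / n ∂(Measure.pi fun _ : Fin n => P)
        + 2 * c₂ * ((∑ s ∈ Finset.range T,
          ∫ S, (∑ i, F s S (S i)) / n ∂(Measure.pi fun _ : Fin n => P)) / T) := by
  set ν : Measure (Fin n → Z) := Measure.pi fun _ => P with hν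
  have hGS : ∀ᵐ S ∂ν, ∀ i, S i ∈ G := ae_pi_mem P hG
  have hGp1 : ∀ᵐ p ∂(ν.prod P), ∀ i, p.1 i ∈ G := Measure.quasiMeasurePreserving_fst.ae hGS
  have hGp2 : ∀ᵐ p ∂(ν.prod P), p.2 ∈ G := Measure.quasiMeasurePreserving_snd.ae hG
  have iprod : ∀ s, Integrable (fun p : (Fin n → Z) × Z => F s p.1 p.2) (ν.prod P) := fun s =>
    Integrable.of_bound (hF s).aestronglyMeasurable K
      (hGp2.mono fun p hp => hK s _ _ hp)
  have itrain : ∀ s i, Integrable (fun S => F s S (S i)) ν := fun s i =>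
    Integrable.of_bound
      ((hF s).comp (measurable_id.prodMk (measurable_pi_apply i))).aestronglyMeasurable K
      (hGS.mono fun S hS => hK s _ _ (hS i))
  have itrain' : ∀ s i, Integrable (fun p : (Fin n → Z) × Z => F s p.1 (p.1 i)) (ν.prod P) :=
    fun s i => (itrain s i).comp_fst P
  have itest : ∀ s i, Integrable
      (fun p : (Fin n → Z) × Z => F s (Function.update p.1 i p.2) (p.1 i)) (ν.prod P) :=
    fun s i => (measurePreserving_update_swap P i).integrable_comp_of_integrable (iprod s)
  have ighost : ∀ s i, Integrable
      (fun p : (Fin n → Z) × Z => F s (Function.update p.1 i p.2) p.2) (ν.prod P) := fun s i => by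
    have := (measurePreserving_update_swap P i).integrable_comp_of_integrable (itrain' s i)
    simpa [Function.comp_def] using this
  have etest : ∀ s i, ∫ p, F s (Function.update p.1 i p.2) (p.1 i) ∂(ν.prod P)
      = ∫ S, ∫ z, F s S z ∂P ∂ν := fun s i => by
    rw [← integral_prod _ (iprod s)]
    have h := measurePreserving_update_swap P i
    conv_rhs => rw [← h.map_eq]
    rw [integral_map h.measurable.aemeasurable (hF s).aestronglyMeasurable]
  have etrain : ∀ s i, ∫ p, F s p.1 (p.1 i) ∂(ν.prod P) = ∫ S, F s S (S i) ∂ν := fun s i => by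
    rw [integral_prod _ (itrain' s i)]
    simp
  have eghost : ∀ s i, ∫ p, F s (Function.update p.1 i p.2) p.2 ∂(ν.prod P)
      = ∫ S, F s S (S i) ∂ν := fun s i => by
    rw [← etrain s i]
    have h := measurePreserving_update_swap P i
    conv_rhs => rw [← h.map_eq]
    have hm : Measurable fun p : (Fin n → Z) × Z => F s p.1 (p.1 i) :=
      (hF s).comp (measurable_fst.prodMk ((measurable_pi_apply i).comp measurable_fst))
    rw [integral_map h.measurable.aemeasurable hm.aestronglyMeasurable]
    simp [hν]
  have hi : ∀ i, (∫ S, ∫ z, F T S z ∂P ∂ν) - ∫ S, F T S (S i) ∂ν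
      ≤ c₁ * ∫ S, F T S (S i) ∂ν
        + 2 * c₂ * ((∑ s ∈ Finset.range T, ∫ S, F s S (S i) ∂ν) / T) := by
    intro i
    have ipair : ∀ s, Integrable (fun p : (Fin n → Z) × Z =>
        F s p.1 (p.1 i) + F s (Function.update p.1 i p.2) p.2) (ν.prod P) :=
      fun s => (itrain' s i).add (ighost s i)
    have isum : Integrable (fun p : (Fin n → Z) × Z => (∑ s ∈ Finset.range T,
        (F s p.1 (p.1 i) + F s (Function.update p.1 i p.2) p.2)) / T) (ν.prod P) :=
      (integrable_finsetSum _ fun s _ => ipair s).div_const _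
    have h := integral_mono_ae ((itest T i).sub (itrain' T i))
      (((itrain' T i).const_mul c₁).add (isum.const_mul c₂)) (by
        filter_upwards [hGp1, hGp2] with p h1 h2
        exact hstab p.1 p.2 i h1 h2)
    simp only [Pi.sub_apply, Pi.add_apply] at h
    rw [integral_sub (itest T i) (itrain' T i), integral_add ((itrain' T i).const_mul c₁)
      (isum.const_mul c₂), integral_const_mul, integral_const_mul, integral_div,
      integral_finsetSum _ fun s _ => ipair s] at h
    simp_rw [integral_add (itrain' _ i) (ighost _ i), etest, etrain, eghost, ← two_mul,
      ← Finset.mul_sum] at h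
    calc _ ≤ _ := h
      _ = _ := by ring
  have ipop : Integrable (fun S => ∫ z, F T S z ∂P) ν := (iprod T).integral_prod_left
  have iavg : ∀ s, Integrable (fun S => (∑ i, F s S (S i)) / (n : ℝ)) ν := fun s =>
    (integrable_finsetSum _ fun i _ => itrain s i).div_const _
  have eavg : ∀ s, ∫ S, (∑ i, F s S (S i)) / (n : ℝ) ∂ν = (∑ i, ∫ S, F s S (S i) ∂ν) / n :=
    fun s => by rw [integral_div, integral_finsetSum _ fun i _ => itrain s i]
  rw [integral_sub ipop (iavg T)]
  simp_rw [eavg]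
  have hsum := Finset.sum_le_sum fun i (_ : i ∈ Finset.univ) => hi i
  simp only [Finset.sum_sub_distrib, Finset.sum_add_distrib, ← Finset.mul_sum, Finset.sum_const,
    Finset.card_univ, Fintype.card_fin, nsmul_eq_mul, ← Finset.sum_div] at hsum
  rw [Finset.sum_comm] at hsum
  have hpos : (0 : ℝ) < n := by exact_mod_cast hn
  rw [← mul_le_mul_iff_left₀ hpos]
  rw [← Finset.sum_div]
  calc _ = _ := ?_
    _ ≤ _ := hsum
    _ = _ := ?_
  · field_simp
  · field_simp

end Resampling

/-- The infimum of a family of continuous functions that is bounded below is Borel measurable. -/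
theorem measurable_ciInf_of_continuous {X ι : Type*} [TopologicalSpace X] [MeasurableSpace X]
    [OpensMeasurableSpace X] {f : ι → X → ℝ} (hf : ∀ i, Continuous (f i))
    (hb : ∀ x, BddBelow (Set.range fun i => f i x)) : Measurable fun x => ⨅ i, f i x :=
  (upperSemicontinuous_ciInf hb fun i => (hf i).upperSemicontinuous).measurable

section ShallowNetwork

variable {d m n : ℕ}

theorem isGDTrajectory_gdIter (hm : 1 ≤ m) (hn : 1 ≤ n) {φ : ℝ → ℝ} {B B' B'' : ℝ}
    (hφ : Differentiable ℝ φ) (hφ' : Differentiable ℝ (deriv φ)) (hB : ∀ s, |φ s| ≤ B)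
    (hB' : ∀ s, |deriv φ s| ≤ B') (hB'' : ∀ s, |deriv (deriv φ) s| ≤ B'') {u : Fin m → ℝ}
    (hu : ∀ k, |u k| = 1 / √m) {Cx Cy C0 η : ℝ} (hC0 : 0 ≤ C0) (hη0 : 0 ≤ η)
    (hη : η * (Cx ^ 2 * (B' ^ 2 + B'' * B + B'' * Cy / √m)) ≤ 1) {W0 : Param d m}
    {S : Fin n → Input d × ℝ}
    (hS : ∀ i, (‖(S i).1‖ ≤ Cx ∧ |(S i).2| ≤ Cy) ∧ sqLoss φ u W0 (S i) ≤ C0) :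
    IsGDTrajectory (resid φ u S) (residGrad φ u S) (B' * Cx) (Cx ^ 2 * B'' / √m) (√m * B + Cy)
      C0 η (gdIter η (empRisk φ u S) W0) where
  card_pos := hn
  feature i := isSmoothFeature_nnet hm hφ hφ' hB' hB'' hu (hS i).1.1 _
  residual_le i W := (abs_sub _ _).trans (add_le_add (abs_nnet_le hm hB hu W _) (hS i).1.2)
  step_nonneg := hη0
  step_le := by
    have h0 : √(m : ℝ) ≠ 0 := (Real.sqrt_pos.2 (by exact_mod_cast hm)).ne'
    refine le_trans (le_of_eq ?_) hη
    field_simp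
    ring
  init_nonneg := hC0
  init_le i := (hS i).2
  succ s := by rw [← gradient_empRisk hm hφ hφ' hB' hB'' hu]; rfl

/-- The width condition makes the total negative curvature along the trajectory small. -/
theorem curvature_le_of_width {M κ₀ C τ w : ℝ} (hM : 0 ≤ M) (hκ : 0 ≤ κ₀) (hτ : 0 ≤ τ)
    (hC : 0 ≤ C) (hw : 0 < w)
    (h : 144 * τ ^ 2 * κ₀ ^ 2 * C * (4 * M * √τ + √2) ^ 2 ≤ w) :
    τ * (κ₀ / √w * (residualBound M C τ + M * (√2 * √τ * √C))) ≤ 1 / 12 := by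
  have h1 : 12 * τ * κ₀ * √C * (4 * M * √τ + √2) ≤ √w := by
    refine Real.le_sqrt_of_sq_le (le_trans (le_of_eq ?_) h)
    simp only [mul_pow, Real.sq_sqrt hC]
    ring
  have h2 : √2 ≤ 2 := by
    rw [Real.sqrt_le_left (by norm_num)]; norm_num
  have h3 : residualBound M C τ + M * (√2 * √τ * √C) ≤ √C * (4 * M * √τ + √2) := by
    have : √2 * (M * √τ * √C) ≤ 2 * (M * √τ * √C) := by gcongr
    unfold residualBound
    linarith
  have hw' : 0 < √w := Real.sqrt_pos.2 hw
  calc _ ≤ τ * (κ₀ / √w * (√C * (4 * M * √τ + √2))) := by gcongr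
    _ = (12 * τ * κ₀ * √C * (4 * M * √τ + √2)) / √w / 12 := by ring
    _ ≤ √w / √w / 12 := by gcongr
    _ = 1 / 12 := by rw [div_self hw'.ne']

theorem stability_constant_le {M r lam A X : ℝ} (hr : 0 ≤ r) (hlam : lam = M ^ 2 * r) (hA : 0 ≤ A)
    (hX : 0 ≤ X) (hAX : A ≤ 3 * X) :
    lam * A + 2 * ((lam + lam ^ 2) * (5 / 2)) * A
      ≤ 16 * Real.exp 3 * (lam * ((1 + M ^ 2) * (1 + r))) * X := by
  have hlam0 : 0 ≤ lam := by rw [hlam]; positivity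
  have hexp : 4 ≤ Real.exp 3 := by linarith [Real.add_one_le_exp 3]
  have h1 : 1 + lam ≤ (1 + M ^ 2) * (1 + r) := by
    rw [hlam]
    linarith [sq_nonneg M]
  have hY : 0 ≤ lam * (1 + lam) := by positivity
  have hlamA : 0 ≤ lam ^ 2 * A := by positivity
  calc _ ≤ 6 * (lam * (1 + lam)) * A := by linarith
    _ ≤ 6 * (lam * (1 + lam)) * (3 * X) := by gcongr
    _ ≤ 16 * 4 * (lam * (1 + lam)) * X := by linarith [mul_nonneg hY hX]
    _ ≤ _ := by gcongr

end ShallowNetwork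

/-- Oracle bound on the expected generalisation gap of gradient descent on shallow networks. -/
theorem statement18 {d m n : ℕ} (hmpos : 1 ≤ m) (hn : 1 ≤ n)
    (φ : ℝ → ℝ) (Bφ Bφ' Bφ'' : ℝ)
    (hφ : Differentiable ℝ φ) (hφ' : Differentiable ℝ (deriv φ))
    (hBφ : ∀ s : ℝ, |φ s| ≤ Bφ) (hBφ' : ∀ s : ℝ, |deriv φ s| ≤ Bφ')
    (hBφ'' : ∀ s : ℝ, |deriv (deriv φ) s| ≤ Bφ'')
    (u : Fin m → ℝ) (hu : ∀ k, u k = 1 / Real.sqrt m ∨ u k = -(1 / Real.sqrt m))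
    (Cx Cy C0 : ℝ) (hCx : 0 < Cx) (hCy : 0 < Cy) (hC0 : 0 < C0)
    (P : Measure (Input d × ℝ)) [IsProbabilityMeasure P]
    (hsupp : ∀ᵐ z ∂P, ‖z.1‖ ≤ Cx ∧ |z.2| ≤ Cy)
    (W0 : Param d m) (hloss0 : ∀ᵐ z ∂P, sqLoss φ u W0 z ≤ C0)
    (ρ : ℝ) (hρ : ρ = Cx ^ 2 * (Bφ' ^ 2 + Bφ'' * Bφ + Bφ'' * Cy / Real.sqrt m))
    (η : ℝ) (hη0 : 0 < η) (hη : η * (2 * ρ) ≤ 1)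
    (T : ℕ) (hT : 1 ≤ T)
    (hm : 144 * (η * T) ^ 2 * Cx ^ 4 * C0 * Bφ'' ^ 2
        * (4 * Bφ' * Cx * Real.sqrt (η * T) + Real.sqrt 2) ^ 2 ≤ (m : ℝ))
    (b btilde : ℝ)
    (hb : b = 16 * Real.exp 3 * Cx ^ 2 * Bφ' ^ 2 * (1 + Cx ^ 2 * Bφ' ^ 2))
    (hbtilde : btilde = Cx ^ 2 * Bφ'' * (Bφ' * Cx + C0)) :
    (∫ S, (popRisk φ u P (gdIter η (empRisk φ u S) W0 T)
          - empRisk φ u S (gdIter η (empRisk φ u S) W0 T))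
        ∂(Measure.pi fun _ : Fin n => P))
      ≤ b * (η * T / n) * (1 + η * T / n)
          * ∫ S, ((⨅ W : Param d m,
                (empRisk φ u S W + ‖W - W0‖ ^ 2 / (η * T)
                  + btilde * ‖W - W0‖ ^ 3 / Real.sqrt m))
              + btilde * C0 * (η * T) ^ ((3 : ℝ) / 2) / Real.sqrt m)
            ∂(Measure.pi fun _ : Fin n => P) := by
  have hm0 : (0 : ℝ) < m := by exact_mod_cast hmpos
  have hT0 : (0 : ℝ) < T := by exact_mod_cast hT
  have hBn : 0 ≤ Bφ := (abs_nonneg _).trans (hBφ 0)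
  have hBn' : 0 ≤ Bφ' := (abs_nonneg _).trans (hBφ' 0)
  have hBn'' : 0 ≤ Bφ'' := (abs_nonneg _).trans (hBφ'' 0)
  have hbt : 0 ≤ btilde := by rw [hbtilde]; positivity
  have hu' : ∀ k, |u k| = 1 / √(m : ℝ) := fun k => by
    have h0 : (0 : ℝ) ≤ 1 / √m := by positivity
    rcases hu k with h | h <;> rw [h]
    · exact abs_of_nonneg h0
    · rw [abs_neg, abs_of_nonneg h0]
  have hρ0 : 0 ≤ ρ := by rw [hρ]; positivity
  have hηρ : η * (Cx ^ 2 * (Bφ' ^ 2 + Bφ'' * Bφ + Bφ'' * Cy / √m)) ≤ 1 := by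
    rw [← hρ]; nlinarith [mul_nonneg hη0.le hρ0]
  have hηM : η * (2 * (Bφ' * Cx) ^ 2) ≤ 1 := by
    refine le_trans ?_ hη
    gcongr
    rw [hρ]
    have : 0 ≤ Cx ^ 2 * (Bφ'' * Bφ + Bφ'' * Cy / √m) := by positivity
    linarith
  set M := Bφ' * Cx with hM
  have hM0 : 0 ≤ M := by positivity
  set κ := Cx ^ 2 * Bφ'' / √(m : ℝ) with hκ
  have hκ0 : 0 ≤ κ := by positivity
  have hcurv : η * T * (κ * (residualBound M C0 (η * T) + M * (√2 * √(η * T) * √C0))) ≤ 1 / 12 :=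
    curvature_le_of_width hM0 (by positivity) (by positivity) hC0.le hm0
      (le_trans (le_of_eq (by rw [hM]; ring)) hm)
  have hcurv' : η * T * (residualBound M C0 (η * T) * κ) ≤ 1 / 12 := by
    refine le_trans ?_ hcurv
    rw [mul_comm _ κ]
    have : 0 ≤ M * (√2 * √(η * T) * √C0) := by positivity
    gcongr
    linarith
  set G : Set (Input d × ℝ) := {z | (‖z.1‖ ≤ Cx ∧ |z.2| ≤ Cy) ∧ sqLoss φ u W0 z ≤ C0} with hGdef
  have hG : ∀ᵐ z ∂P, z ∈ G := by
    filter_upwards [hsupp, hloss0] with z h1 h2 using ⟨h1, h2⟩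
  have htraj : ∀ S : Fin n → Input d × ℝ, (∀ i, S i ∈ G) →
      IsGDTrajectory (resid φ u S) (residGrad φ u S) M κ (√m * Bφ + Cy) C0 η
        (gdIter η (empRisk φ u S) W0) := fun S hS =>
    isGDTrajectory_gdIter hmpos hn hφ hφ' hBφ hBφ' hBφ'' hu' hC0.le hη0.le hηρ hS
  have hloss : ∀ (W : Param d m), ∀ z ∈ G, |sqLoss φ u W z| ≤ (√m * Bφ + Cy) ^ 2 / 2 := by
    intro W z hz
    rw [sqLoss, abs_of_nonneg (by positivity), ← sq_abs]
    gcongr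
    exact (abs_sub _ _).trans (add_le_add (abs_nnet_le hmpos hBφ hu' W _) hz.1.2)
  set ν : Measure (Fin n → Input d × ℝ) := Measure.pi fun _ => P with hν
  set w : (Fin n → Input d × ℝ) → ℕ → Param d m := fun S => gdIter η (empRisk φ u S) W0 with hw
  have hwc : ∀ s, Continuous fun S => w S s :=
    continuous_gdIter hmpos hφ hφ' hBφ' hBφ'' hu' η W0
  set lam := M ^ 2 * (η * T / n) with hlam
  have hlam0 : 0 ≤ lam := by positivity
  have hgap := expected_gap_le_of_replace_one P hn T (fun s S z => sqLoss φ u (w S s) z)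
    (fun s => (continuous_sqLoss hφ.continuous u ((hwc s).comp continuous_fst) continuous_snd).measurable)
    hG (fun s S z hz => hloss (w S s) z hz) (c₁ := lam) (c₂ := (lam + lam ^ 2) * (5 / 2))
    (fun S z i hS hz => by
      have hS' : ∀ j, Function.update S i z j ∈ G := by
        intro j
        rcases eq_or_ne j i with rfl | hj
        · simpa using hz
        · simpa [hj] using hS j
      have h := (htraj S hS).loss_sub_le (htraj _ hS') rfl (i := i)
        (fun j hj => by funext W; simp [resid, hj]) (fun j hj => by funext W; simp [residGrad, hj])
        hT hcurv hlam
      simp only [resid, Function.update_self] at h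
      exact h)
  have hGS : ∀ᵐ S ∂ν, ∀ i, S i ∈ G := ae_pi_mem P hG
  have hER : ∀ s, Integrable (fun S => empRisk φ u S (w S s)) ν := by
    intro s
    have h1 : ∀ i, Integrable (fun S => sqLoss φ u (w S s) (S i)) ν := fun i =>
      Integrable.of_bound
        (continuous_sqLoss hφ.continuous u (hwc s)
          (continuous_apply i)).measurable.aestronglyMeasurable _
        (hGS.mono fun S hS => hloss _ _ (hS i))
    exact (integrable_finsetSum _ fun i _ => h1 i).div_const _
  have hR0 : ∀ (S : Fin n → Input d × ℝ) (W : Param d m), 0 ≤ empRisk φ u S W := fun S W => meanSq_nonneg (resid φ u S) W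
  set obj : Param d m → (Fin n → Input d × ℝ) → ℝ := fun W S =>
    empRisk φ u S W + ‖W - W0‖ ^ 2 / (η * T) + btilde * ‖W - W0‖ ^ 3 / √m with hobj
  have hobj0 : ∀ W S, 0 ≤ obj W S := fun W S => by
    have := hR0 S W
    simp only [hobj]
    positivity
  have hbdd : ∀ S, BddBelow (Set.range fun W => obj W S) := fun S =>
    ⟨0, by rintro _ ⟨W, rfl⟩; exact hobj0 W S⟩
  have hI : Integrable (fun S => ⨅ W, obj W S) ν := by
    refine Integrable.of_bound (C := C0) (measurable_ciInf_of_continuous (fun W => ?_)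
      hbdd).aestronglyMeasurable (hGS.mono fun S hS => ?_)
    · exact ((continuous_empRisk hφ.continuous u W).add continuous_const).add continuous_const
    · rw [Real.norm_of_nonneg (Real.iInf_nonneg fun W => hobj0 W S)]
      refine (ciInf_le (hbdd S) W0).trans ?_
      have h : empRisk φ u S W0 ≤ C0 := (htraj S hS).meanSq_init_le
      simpa [hobj] using h
  set avg : ℝ := (∑ s ∈ Finset.range T, ∫ S, empRisk φ u S (w S s) ∂ν) / T with havg
  have heavg : ∫ S, (∑ s ∈ Finset.range T, empRisk φ u S (w S s)) / (T : ℝ) ∂ν = avg := by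
    rw [integral_div, integral_finsetSum _ fun s _ => hER s]
  have hiavg : Integrable (fun S => (∑ s ∈ Finset.range T, empRisk φ u S (w S s)) / (T : ℝ)) ν :=
    (integrable_finsetSum _ fun s _ => hER s).div_const _
  have havg0 : 0 ≤ avg := by
    rw [← heavg]
    exact integral_nonneg fun S => div_nonneg (Finset.sum_nonneg fun s _ => hR0 _ _) hT0.le
  have hlast : ∫ S, empRisk φ u S (w S T) ∂ν ≤ avg := by
    rw [← heavg]
    exact integral_mono_ae (hER T) hiavg (hGS.mono fun S hS => (htraj S hS).le_average hT)
  have horacle : avg ≤ 3 * ∫ S, ⨅ W, obj W S ∂ν := by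
    rw [← heavg, ← integral_const_mul]
    refine integral_mono_ae hiavg (hI.const_mul 3) (hGS.mono fun S hS => ?_)
    change (∑ s ∈ Finset.range T, empRisk φ u S (w S s)) / (T : ℝ) ≤ 3 * ⨅ W, obj W S
    rw [← div_le_iff₀' three_pos]
    refine le_ciInf fun W => ?_
    have h := (htraj S hS).average_le hT hη0 hηM hcurv' W
    have h2 : 0 ≤ btilde * ‖W - W0‖ ^ 3 / √m := by positivity
    rw [div_le_iff₀' three_pos]
    refine h.trans ?_
    gcongr
    exact le_add_of_nonneg_right h2
  have hconst : 0 ≤ btilde * C0 * (η * T) ^ ((3 : ℝ) / 2) / √m := by positivity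
  have hint : ∫ S, ⨅ W, obj W S ∂ν
      ≤ ∫ S, ((⨅ W, obj W S) + btilde * C0 * (η * T) ^ ((3 : ℝ) / 2) / √m) ∂ν :=
    integral_mono hI (hI.add (integrable_const _)) fun S => le_add_of_nonneg_right hconst
  set X := ∫ S, ((⨅ W, obj W S) + btilde * C0 * (η * T) ^ ((3 : ℝ) / 2) / √m) ∂ν with hX
  have hX3 : avg ≤ 3 * X := by linarith
  have hX0 : 0 ≤ X := by linarith
  have hgap' : ∫ S, (popRisk φ u P (w S T) - empRisk φ u S (w S T)) ∂ν
      ≤ lam * avg + 2 * ((lam + lam ^ 2) * (5 / 2)) * avg :=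
    hgap.trans (add_le_add_left (mul_le_mul_of_nonneg_left hlast hlam0) _)
  refine hgap'.trans ((stability_constant_le (by positivity) hlam havg0 hX0 hX3).trans
    (le_of_eq ?_))
  rw [hb, hM]
  ring
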